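/- arXiv:2011.09180 — 5 statements merged into one kernel-verified Lean document; each statement's English description precedes it below -/
import Mathlib

section
/- Let 0 < T < ∞ and let (ν_n) be a sequence of Borel probability measures on ℝ such that sup_n ∫_ℝ e^{T|λ|} dν_n(λ) < ∞. Suppose that there is a dense subset D of (−T, T) such that for every t ∈ D the sequence of Laplace transforms g_n(t) := ∫_ℝ e^{−tλ} dν_n(λ) converges in [0, ∞). Then there exists a Borel probability measure ν on ℝ such that ν_n converges weakly to ν and, for every t ∈ (−T, T), lim_{n→∞} ∫_ℝ e^{−tλ} dν_n(λ) = ∫_ℝ e^{−tλ} dν(λ). -/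
open MeasureTheory Filter Topology

open BoundedContinuousFunction ProbabilityTheory
open scoped NNReal ENNReal

/-- The integral of a continuous nonnegative function is lower semicontinuous under weak
convergence. -/
lemma lintegral_le_of_tendsto_probabilityMeasure {Ω ι : Type*} [TopologicalSpace Ω]
    [MeasurableSpace Ω] [OpensMeasurableSpace Ω] {L : Filter ι} [L.NeBot]
    {μs : ι → ProbabilityMeasure Ω} {μ : ProbabilityMeasure Ω} (h : Tendsto μs L (𝓝 μ))
    {f : Ω → ℝ≥0} (hf : Continuous f) {M : ℝ≥0∞}
    (hM : ∀ i, ∫⁻ x, f x ∂(μs i : Measure Ω) ≤ M) :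
    ∫⁻ x, f x ∂(μ : Measure Ω) ≤ M := by
  have hsup : ∀ x, (f x : ℝ≥0∞) = ⨆ k : ℕ, ((min (f x) k : ℝ≥0) : ℝ≥0∞) := by
    intro x
    apply le_antisymm
    · obtain ⟨k, hk⟩ := exists_nat_ge (f x)
      exact le_iSup_of_le k (by simp [hk])
    · exact iSup_le fun k => by exact_mod_cast min_le_left _ _
  simp_rw [hsup]
  rw [lintegral_iSup]
  · refine iSup_le fun k => ?_
    let g : Ω →ᵇ ℝ≥0 := BoundedContinuousFunction.mkOfBound
      ⟨fun x => min (f x) k, by fun_prop⟩ k (by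
        intro x y
        rw [NNReal.dist_eq, abs_le]
        have h1 : ((min (f x) k : ℝ≥0) : ℝ) ≤ k := by exact_mod_cast min_le_right _ _
        have h2 : ((min (f y) k : ℝ≥0) : ℝ) ≤ k := by exact_mod_cast min_le_right _ _
        have h3 := (min (f x) (k : ℝ≥0)).2
        have h4 := (min (f y) (k : ℝ≥0)).2
        constructor
        · exact (by linarith : -(k : ℝ) ≤ ((min (f x) k : ℝ≥0) : ℝ) - ((min (f y) k : ℝ≥0) : ℝ))
        · exact (by linarith : ((min (f x) k : ℝ≥0) : ℝ) - ((min (f y) k : ℝ≥0) : ℝ) ≤ (k : ℝ)))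
    refine le_of_tendsto' (ProbabilityMeasure.tendsto_iff_forall_lintegral_tendsto.1 h g)
      fun i => le_trans (lintegral_mono fun x => ?_) (hM i)
    exact ENNReal.coe_le_coe.2 (min_le_left (f x) k)
  · intro k
    exact (by fun_prop : Continuous fun x => min (f x) (k : ℝ≥0)).measurable.coe_nnreal_ennreal
  · intro k l hkl x
    simp only [ENNReal.coe_le_coe]
    exact min_le_min_left _ (by exact_mod_cast hkl)

lemma lintegral_exp_mul_abs_le_of_tendsto {ι : Type*} {L : Filter ι} [L.NeBot]
    {μs : ι → ProbabilityMeasure ℝ} {μ : ProbabilityMeasure ℝ} (h : Tendsto μs L (𝓝 μ))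
    {T : ℝ} {M : ℝ≥0∞}
    (hM : ∀ i, ∫⁻ x, ENNReal.ofReal (Real.exp (T * |x|)) ∂(μs i : Measure ℝ) ≤ M) :
    ∫⁻ x, ENNReal.ofReal (Real.exp (T * |x|)) ∂(μ : Measure ℝ) ≤ M :=
  lintegral_le_of_tendsto_probabilityMeasure (f := fun x => (Real.exp (T * |x|)).toNNReal) h
    (by fun_prop) hM

lemma integrable_exp_mul_abs_of_lintegral_le {μ : Measure ℝ} {T : ℝ} {M : ℝ≥0∞} (hM : M ≠ ⊤)
    (h : ∫⁻ x, ENNReal.ofReal (Real.exp (T * |x|)) ∂μ ≤ M) :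
    Integrable (fun x => Real.exp (T * |x|)) μ := by
  refine ⟨by fun_prop, ?_⟩
  rw [hasFiniteIntegral_iff_ofReal (ae_of_all _ fun x => (Real.exp_pos _).le)]
  exact h.trans_lt hM.lt_top

lemma integral_exp_mul_abs_le_of_lintegral_le {μ : Measure ℝ} {T : ℝ} {M : ℝ≥0∞} (hM : M ≠ ⊤)
    (h : ∫⁻ x, ENNReal.ofReal (Real.exp (T * |x|)) ∂μ ≤ M) :
    ∫ x, Real.exp (T * |x|) ∂μ ≤ M.toReal := by
  rw [integral_eq_lintegral_of_nonneg_ae (ae_of_all _ fun x => (Real.exp_pos _).le)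
    (by fun_prop)]
  exact ENNReal.toReal_mono hM h

lemma integrable_exp_mul_of_integrable_exp_mul_abs {μ : Measure ℝ} {T s : ℝ} (hs : |s| ≤ T)
    (h : Integrable (fun x => Real.exp (T * |x|)) μ) :
    Integrable (fun x => Real.exp (s * x)) μ := by
  refine h.mono' (by fun_prop) (ae_of_all _ fun x => ?_)
  rw [Real.norm_eq_abs, Real.abs_exp, Real.exp_le_exp]
  calc s * x ≤ |s * x| := le_abs_self _
    _ = |s| * |x| := abs_mul _ _
    _ ≤ T * |x| := by gcongr

/-- The error made by truncating `exp (s * x)` at height `exp (|s| * R)`, as controlled by an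
exponential moment of order `T > |s|`. -/
lemma abs_exp_mul_sub_min_le {T s R : ℝ} (hs : |s| ≤ T) (x : ℝ) :
    |Real.exp (s * x) - min (Real.exp (s * x)) (Real.exp (|s| * R))|
      ≤ Real.exp (-((T - |s|) * R)) * Real.exp (T * |x|) := by
  have hle : s * x ≤ |s| * |x| := (le_abs_self _).trans (abs_mul _ _).le
  rcases le_or_gt (s * x) (|s| * R) with hx | hx
  · rw [min_eq_left (Real.exp_le_exp.2 hx), sub_self, abs_zero]
    positivity
  · rw [min_eq_right (Real.exp_le_exp.2 hx.le), abs_of_nonneg (by simpa using hx.le)]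
    have hR : R ≤ |x| := by
      by_contra! hlt
      exact absurd (hle.trans (mul_le_mul_of_nonneg_left hlt.le (abs_nonneg s))) hx.not_ge
    calc Real.exp (s * x) - Real.exp (|s| * R) ≤ Real.exp (s * x) := by
          linarith [Real.exp_pos (|s| * R)]
      _ ≤ Real.exp (-((T - |s|) * R) + T * |x|) := by
          rw [Real.exp_le_exp]
          nlinarith [mul_le_mul_of_nonneg_left hR (sub_nonneg.2 hs)]
      _ = _ := Real.exp_add _ _

lemma abs_integral_exp_mul_sub_integral_min_le {μ : Measure ℝ} [IsFiniteMeasure μ] {T s C : ℝ}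
    (hs : |s| ≤ T) (h : Integrable (fun x => Real.exp (T * |x|)) μ)
    (hC : ∫ x, Real.exp (T * |x|) ∂μ ≤ C) (R : ℝ) :
    |∫ x, Real.exp (s * x) ∂μ - ∫ x, min (Real.exp (s * x)) (Real.exp (|s| * R)) ∂μ|
      ≤ Real.exp (-((T - |s|) * R)) * C := by
  have hexp := integrable_exp_mul_of_integrable_exp_mul_abs hs h
  have hmin : Integrable (fun x => min (Real.exp (s * x)) (Real.exp (|s| * R))) μ :=
    hexp.inf (integrable_const _)
  rw [← integral_sub hexp hmin, ← Real.norm_eq_abs]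
  refine (norm_integral_le_of_norm_le
    (h.const_mul (Real.exp (-((T - |s|) * R))))
    (ae_of_all _ fun x => abs_exp_mul_sub_min_le hs x)).trans ?_
  rw [integral_const_mul]
  gcongr

/-- Under a uniform bound on exponential moments of order `T`, weak convergence implies convergence
of moment-generating functions on `(-T, T)`. -/
lemma tendsto_integral_exp_mul_of_tendsto {ι : Type*} {L : Filter ι} [L.NeBot]
    {μs : ι → ProbabilityMeasure ℝ} {μ : ProbabilityMeasure ℝ} (h : Tendsto μs L (𝓝 μ))
    {T : ℝ} {M : ℝ≥0∞} (hMtop : M ≠ ⊤)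
    (hM : ∀ i, ∫⁻ x, ENNReal.ofReal (Real.exp (T * |x|)) ∂(μs i : Measure ℝ) ≤ M)
    {s : ℝ} (hs : |s| < T) :
    Tendsto (fun i => ∫ x, Real.exp (s * x) ∂(μs i : Measure ℝ)) L
      (𝓝 (∫ x, Real.exp (s * x) ∂(μ : Measure ℝ))) := by
  have hMμ := lintegral_exp_mul_abs_le_of_tendsto h hM
  rw [Metric.tendsto_nhds]
  intro ε hε
  have hlim : Tendsto (fun R => Real.exp (-((T - |s|) * R)) * M.toReal) atTop (𝓝 0) := by
    simpa using ((Real.tendsto_exp_neg_atTop_nhds_zero.comp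
      (tendsto_id.const_mul_atTop (sub_pos.2 hs))).mul_const M.toReal)
  obtain ⟨R, hR⟩ := (hlim.eventually_lt_const (by positivity : 0 < ε / 3)).exists
  let g : ℝ →ᵇ ℝ := BoundedContinuousFunction.ofNormedAddCommGroup
    (fun x => min (Real.exp (s * x)) (Real.exp (|s| * R))) (by fun_prop) (Real.exp (|s| * R)) (by
      intro x
      rw [Real.norm_of_nonneg (by positivity)]
      exact min_le_right _ _)
  have hg := Metric.tendsto_nhds.1
    (ProbabilityMeasure.tendsto_iff_forall_integral_tendsto.1 h g) (ε / 3) (by positivity)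
  filter_upwards [hg] with i hi
  have h1 := abs_integral_exp_mul_sub_integral_min_le hs.le
    (integrable_exp_mul_abs_of_lintegral_le hMtop (hM i))
    (integral_exp_mul_abs_le_of_lintegral_le hMtop (hM i)) R
  have h2 := abs_integral_exp_mul_sub_integral_min_le hs.le
    (integrable_exp_mul_abs_of_lintegral_le hMtop hMμ)
    (integral_exp_mul_abs_le_of_lintegral_le hMtop hMμ) R
  rw [Real.dist_eq] at hi ⊢
  change |∫ x, min (Real.exp (s * x)) (Real.exp (|s| * R)) ∂(μs i : Measure ℝ)
    - ∫ x, min (Real.exp (s * x)) (Real.exp (|s| * R)) ∂(μ : Measure ℝ)| < ε / 3 at hi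
  rw [abs_lt] at hi ⊢
  rw [abs_le] at h1 h2
  constructor <;> linarith [h1.1, h1.2, h2.1, h2.2, hi.1, hi.2]

lemma isTightMeasureSet_of_lintegral_exp_mul_abs_le {S : Set (Measure ℝ)} {T : ℝ} (hT : 0 < T)
    {M : ℝ≥0∞} (hMtop : M ≠ ⊤)
    (hM : ∀ μ ∈ S, ∫⁻ x, ENNReal.ofReal (Real.exp (T * |x|)) ∂μ ≤ M) :
    IsTightMeasureSet S := by
  refine isTightMeasureSet_of_tendsto_measure_norm_gt ?_
  have hlim : Tendsto (fun r : ℝ => M / ENNReal.ofReal (Real.exp (T * r))) atTop (𝓝 0) := by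
    have : Tendsto (fun r : ℝ => ENNReal.ofReal (Real.exp (T * r))) atTop (𝓝 ⊤) :=
      ENNReal.tendsto_ofReal_nhds_top.2
        (Real.tendsto_exp_atTop.comp (tendsto_id.const_mul_atTop hT))
    simpa using ENNReal.Tendsto.const_div this (Or.inr hMtop)
  refine tendsto_of_tendsto_of_tendsto_of_le_of_le tendsto_const_nhds hlim (fun _ => zero_le) ?_
  intro r
  refine iSup₂_le fun μ hμ => ?_
  calc μ {x | r < ‖x‖}
      ≤ μ {x | ENNReal.ofReal (Real.exp (T * r)) ≤ ENNReal.ofReal (Real.exp (T * |x|))} := by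
        refine measure_mono fun x (hx : r < ‖x‖) => ?_
        refine ENNReal.ofReal_le_ofReal (Real.exp_le_exp.2 ?_)
        exact mul_le_mul_of_nonneg_left hx.le hT.le
    _ ≤ (∫⁻ x, ENNReal.ofReal (Real.exp (T * |x|)) ∂μ) / ENNReal.ofReal (Real.exp (T * r)) :=
        meas_ge_le_lintegral_div (by fun_prop) (by simp [Real.exp_pos]) ENNReal.ofReal_ne_top
    _ ≤ _ := ENNReal.div_le_div_right (hM μ hμ) _

/-- Two finite measures with finite moment-generating functions on `(-T, T)` are equal as soon as
these functions agree on a set accumulating at `0`. -/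
lemma MeasureTheory.Measure.ext_of_frequently_mgf_eq {μ μ' : Measure ℝ} [IsFiniteMeasure μ]
    [IsFiniteMeasure μ'] {T : ℝ} (hT : 0 < T)
    (hμ : Set.Ioo (-T) T ⊆ integrableExpSet id μ) (hμ' : Set.Ioo (-T) T ⊆ integrableExpSet id μ')
    (h : ∃ᶠ t in 𝓝[≠] (0 : ℝ), mgf id μ t = mgf id μ' t) : μ = μ' := by
  have hmem : ∀ {ρ : Measure ℝ}, Set.Ioo (-T) T ⊆ integrableExpSet id ρ →
      {z : ℂ | z.re ∈ Set.Ioo (-T) T} ⊆ {z | z.re ∈ interior (integrableExpSet id ρ)} :=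
    fun hρ z hz => interior_maximal hρ isOpen_Ioo hz
  have hEq : Set.EqOn (complexMGF id μ) (complexMGF id μ') {z : ℂ | z.re ∈ Set.Ioo (-T) T} := by
    refine AnalyticOnNhd.eqOn_of_preconnected_of_frequently_eq (z₀ := 0)
      (analyticOnNhd_complexMGF.mono (hmem hμ)) (analyticOnNhd_complexMGF.mono (hmem hμ'))
      ((convex_Ioo (-T) T).linear_preimage Complex.reLm).isPreconnected (by simp [hT]) ?_
    have ht : Tendsto (fun t : ℝ => (t : ℂ)) (𝓝[≠] 0) (𝓝[≠] 0) := by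
      refine tendsto_nhdsWithin_iff.2 ⟨?_, ?_⟩
      · exact (Complex.continuous_ofReal.tendsto' 0 0 rfl).mono_left nhdsWithin_le_nhds
      · filter_upwards [self_mem_nhdsWithin] with t ht
        simpa using ht
    refine ht.frequently (h.mono fun t ht => ?_)
    rw [complexMGF_ofReal, complexMGF_ofReal, ht]
  refine Measure.ext_of_charFun (funext fun t => ?_)
  rw [← complexMGF_id_mul_I, ← complexMGF_id_mul_I]
  exact hEq (by simp [hT])

/-- If probability measures `ν n` on `ℝ` have uniformly bounded exponential
moments of order `T` and their Laplace transforms converge on a dense subset of `(-T, T)`,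
then the `ν n` converge weakly to a probability measure `ν` and the Laplace transforms
converge to that of `ν` on all of `(-T, T)`. -/
theorem stmt_0 (T : ℝ) (hT : 0 < T)
    (ν : ℕ → Measure ℝ) (hprob : ∀ n, IsProbabilityMeasure (ν n))
    (hmom : ⨆ n, ∫⁻ l, ENNReal.ofReal (Real.exp (T * |l|)) ∂(ν n) < ⊤)
    (D : Set ℝ) (hD : D ⊆ Set.Ioo (-T) T) (hdense : Set.Ioo (-T) T ⊆ closure D)
    (hconv : ∀ t ∈ D, ∃ l : ℝ, 0 ≤ l ∧
      Tendsto (fun n => ∫ x, Real.exp (-t * x) ∂(ν n)) atTop (𝓝 l)) :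
    ∃ μ : Measure ℝ, IsProbabilityMeasure μ ∧
      (∀ f : BoundedContinuousFunction ℝ ℝ,
        Tendsto (fun n => ∫ x, f x ∂(ν n)) atTop (𝓝 (∫ x, f x ∂μ))) ∧
      (∀ t ∈ Set.Ioo (-T) T,
        Tendsto (fun n => ∫ x, Real.exp (-t * x) ∂(ν n)) atTop
          (𝓝 (∫ x, Real.exp (-t * x) ∂μ))) := by
  set M : ℝ≥0∞ := ⨆ n, ∫⁻ l, ENNReal.ofReal (Real.exp (T * |l|)) ∂(ν n)
  let P : ℕ → ProbabilityMeasure ℝ := fun n => ⟨ν n, hprob n⟩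
  have hM : ∀ n, ∫⁻ x, ENNReal.ofReal (Real.exp (T * |x|)) ∂(P n : Measure ℝ) ≤ M :=
    fun n => le_iSup (fun n => ∫⁻ l, ENNReal.ofReal (Real.exp (T * |l|)) ∂(ν n)) n
  have hcompact : IsCompact (closure (Set.range P)) := by
    refine isCompact_closure_of_isTightMeasureSet
      (isTightMeasureSet_of_lintegral_exp_mul_abs_le hT hmom.ne ?_)
    rintro _ ⟨_, ⟨n, rfl⟩, rfl⟩
    exact hM n
  have hmemP : ∀ n, P n ∈ closure (Set.range P) := fun n => subset_closure (Set.mem_range_self n)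
  have hcluster : ∀ μ, MapClusterPt μ atTop P →
      Set.Ioo (-T) T ⊆ integrableExpSet id (μ : Measure ℝ) ∧
      ∀ t ∈ D, Tendsto (fun n => ∫ x, Real.exp (-t * x) ∂(ν n)) atTop
        (𝓝 (mgf id (μ : Measure ℝ) (-t))) := by
    intro μ hμ
    obtain ⟨U, hU, hUμ⟩ := mapClusterPt_iff_ultrafilter.1 hμ
    refine ⟨fun s hs => ?_, fun t ht => ?_⟩
    · exact integrable_exp_mul_of_integrable_exp_mul_abs (abs_le.2 ⟨hs.1.le, hs.2.le⟩)
        (integrable_exp_mul_abs_of_lintegral_le hmom.ne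
          (lintegral_exp_mul_abs_le_of_tendsto hUμ hM))
    · obtain ⟨l, -, hl⟩ := hconv t ht
      have hlim := tendsto_integral_exp_mul_of_tendsto hUμ hmom.ne hM (s := -t)
        (by rw [abs_neg]; exact abs_lt.2 (hD ht))
      rwa [tendsto_nhds_unique (hl.mono_left hU) hlim] at hl
  have hfreq : ∃ᶠ t in 𝓝[≠] (0 : ℝ), -t ∈ D := by
    have hacc : ∃ᶠ t in 𝓝[≠] (0 : ℝ), t ∈ D := by
      refine frequently_nhdsWithin_iff.2 (mem_closure_iff_frequently (s := D ∩ {0}ᶜ).1 ?_)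
      have hopen : Set.Ioo (-T) T ∩ {0}ᶜ ⊆ closure (D ∩ {0}ᶜ) := fun x hx =>
        closure_mono (by rw [Set.inter_comm])
          (isOpen_compl_singleton.inter_closure ⟨hx.2, hdense hx.1⟩)
      refine closure_minimal hopen isClosed_closure ?_
      have h0 : (0 : ℝ) ∈ closure ({0}ᶜ : Set ℝ) := by simp
      exact isOpen_Ioo.inter_closure ⟨by simp [hT], h0⟩
    have hneg : Tendsto (fun t : ℝ => -t) (𝓝[≠] 0) (𝓝[≠] 0) := by
      refine tendsto_nhdsWithin_iff.2 ⟨?_, ?_⟩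
      · exact (continuous_neg.tendsto' (0 : ℝ) 0 neg_zero).mono_left nhdsWithin_le_nhds
      · filter_upwards [self_mem_nhdsWithin] with t ht
        simpa using ht
    exact hneg.frequently (hacc.mono fun t ht => by rwa [neg_neg])
  obtain ⟨μ, -, hμ⟩ := hcompact.exists_mapClusterPt (f := atTop) (u := P)
    (tendsto_principal.2 (Eventually.of_forall hmemP))
  have htend : Tendsto P atTop (𝓝 μ) := by
    refine hcompact.tendsto_nhds_of_unique_mapClusterPt (Eventually.of_forall hmemP)
      fun ρ _ hρ => Subtype.ext ?_
    exact Measure.ext_of_frequently_mgf_eq (μ := (ρ : Measure ℝ)) (μ' := (μ : Measure ℝ)) hT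
      (hcluster ρ hρ).1 (hcluster μ hμ).1
      (hfreq.mono fun t ht => by
        simpa using tendsto_nhds_unique ((hcluster ρ hρ).2 _ ht) ((hcluster μ hμ).2 _ ht))
  refine ⟨μ, inferInstance, ProbabilityMeasure.tendsto_iff_forall_integral_tendsto.1 htend,
    fun t ht => ?_⟩
  exact tendsto_integral_exp_mul_of_tendsto htend hmom.ne hM (s := -t)
    (by rw [abs_neg]; exact abs_lt.2 ht)
end

section
/- Let 0 < T₁ < T₂ < ∞, let ν be a finite Borel measure on [0, ∞) such that ∫_{[0,∞)} e^{tλ} dν(λ) < ∞ for every t ∈ (0, T₁), and let g be an analytic function on the strip {z ∈ ℂ : Re(z) ∈ (0, T₂)}. If ∫_{[0,∞)} e^{tλ} dν(λ) = g(t) for every t ∈ (0, T₁), then ∫_{[0,∞)} e^{tλ} dν(λ) is finite and equals g(t) for every t ∈ (0, T₂). -/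
open MeasureTheory ProbabilityTheory Filter Topology

/-- If `complexMGF X μ` of a nonnegative `X` agrees near the real point `c` with a function
holomorphic on the disc of radius `r` around `c`, then `exp (t * X)` is integrable for
`c ≤ t < c + r`. -/
theorem mem_integrableExpSet_of_eventuallyEq_complexMGF {Ω : Type*} [MeasurableSpace Ω]
    {μ : Measure Ω} {X : Ω → ℝ} (hX : ∀ᵐ ω ∂μ, 0 ≤ X ω) {g : ℂ → ℂ} {c r t : ℝ}
    (hc : c ∈ interior (integrableExpSet X μ))
    (hg : DifferentiableOn ℂ g (Metric.ball (c : ℂ) r))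
    (heq : g =ᶠ[𝓝 (c : ℂ)] complexMGF X μ) (hct : c ≤ t) (htr : t < c + r) :
    t ∈ integrableExpSet X μ := by
  have hXm : AEMeasurable X μ := aemeasurable_of_mem_interior_integrableExpSet hc
  set F : ℕ → Ω → ℝ := fun n ω ↦
    (n.factorial : ℝ)⁻¹ * (t - c) ^ n * (X ω ^ n * Real.exp (c * X ω)) with hF
  have hFint (n : ℕ) : Integrable (F n) μ :=
    (integrable_pow_mul_exp_of_mem_interior_integrableExpSet hc n).const_mul _
  have hFnonneg (n : ℕ) : ∀ᵐ ω ∂μ, 0 ≤ F n ω := by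
    filter_upwards [hX] with ω hω
    have := sub_nonneg.2 hct
    positivity
  have hFsum (ω : Ω) : HasSum (fun n ↦ F n ω) (Real.exp (t * X ω)) := by
    have h := (NormedSpace.expSeries_div_hasSum_exp ((t - c) * X ω)).mul_right
      (Real.exp (c * X ω))
    rw [← Real.exp_eq_exp_ℝ, ← Real.exp_add] at h
    have hexp : (t - c) * X ω + c * X ω = t * X ω := by ring
    rw [hexp] at h
    have hF_eq : (fun n ↦ F n ω) =
        fun n ↦ ((t - c) * X ω) ^ n / (n.factorial : ℝ) * Real.exp (c * X ω) := by
      funext n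
      simp only [hF, mul_pow]
      ring
    rw [hF_eq]
    exact h
  have hsum : Summable fun n ↦ ∫ ω, F n ω ∂μ := by
    have ht : (t : ℂ) ∈ Metric.ball (c : ℂ) r := by
      rw [Metric.mem_ball, Complex.dist_eq, ← Complex.ofReal_sub, Complex.norm_real,
        Real.norm_of_nonneg (sub_nonneg.2 hct)]
      linarith
    rw [← Complex.summable_ofReal]
    refine (Complex.hasSum_taylorSeries_on_ball hg ht).summable.congr fun n ↦ ?_
    rw [heq.iteratedDeriv_eq n, iteratedDeriv_complexMGF (by simpa using hc)]
    simp only [hF, integral_const_mul, smul_eq_mul]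
    push_cast
    rw [← integral_complex_ofReal]
    push_cast
    ring
  refine ⟨(Real.measurable_exp.comp_aemeasurable (hXm.const_mul t)).aestronglyMeasurable, ?_⟩
  rw [hasFiniteIntegral_iff_ofReal (ae_of_all _ fun ω ↦ (Real.exp_pos _).le)]
  have hpt : ∀ᵐ ω ∂μ, ENNReal.ofReal (Real.exp (t * X ω)) = ∑' n, ENNReal.ofReal (F n ω) := by
    filter_upwards [ae_all_iff.2 hFnonneg] with ω hω
    rw [← (hFsum ω).tsum_eq, ENNReal.ofReal_tsum_of_nonneg hω (hFsum ω).summable]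
  rw [lintegral_congr_ae hpt,
    lintegral_tsum fun n ↦ (hFint n).aestronglyMeasurable.aemeasurable.ennreal_ofReal]
  simp_rw [← fun n ↦ ofReal_integral_eq_lintegral_ofReal (hFint n) (hFnonneg n)]
  rw [← ENNReal.ofReal_tsum_of_nonneg (fun n ↦ integral_nonneg_of_ae (hFnonneg n)) hsum]
  exact ENNReal.ofReal_lt_top

/-- A function analytic on a vertical strip which agrees with `mgf X μ` on an initial real
segment agrees with `complexMGF X μ` on the strip, if `exp (t * X)` is integrable there. -/
theorem eqOn_complexMGF_of_eqOn_mgf {Ω : Type*} [MeasurableSpace Ω]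
    {μ : Measure Ω} {X : Ω → ℝ} {g : ℂ → ℂ} {a b d : ℝ} (had : a < d) (hdb : d ≤ b)
    (hint : Set.Ioo a b ⊆ integrableExpSet X μ)
    (hg : AnalyticOnNhd ℂ g {z : ℂ | z.re ∈ Set.Ioo a b})
    (heq : ∀ t ∈ Set.Ioo a d, g t = mgf X μ t) :
    Set.EqOn g (complexMGF X μ) {z : ℂ | z.re ∈ Set.Ioo a b} := by
  have hconv : Convex ℝ {z : ℂ | z.re ∈ Set.Ioo a b} :=
    (convex_Ioo a b).linear_preimage Complex.reLm
  obtain ⟨m, hm⟩ := Set.nonempty_Ioo.2 had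
  have hcoe : Tendsto ((↑) : ℝ → ℂ) (𝓝[≠] m) (𝓝[≠] (m : ℂ)) :=
    (Complex.continuous_ofReal.tendsto m).inf (tendsto_principal_principal.2 fun x hx ↦ by
      simpa using hx)
  refine AnalyticOnNhd.eqOn_of_preconnected_of_frequently_eq (𝕜 := ℂ) hg
    (analyticOnNhd_complexMGF.mono fun z hz ↦ interior_maximal hint isOpen_Ioo hz)
    hconv.isPreconnected (z₀ := m) ⟨by simpa using hm.1, by simpa using hm.2.trans_le hdb⟩
    (hcoe.frequently (Eventually.frequently ?_))
  filter_upwards [mem_nhdsWithin_of_mem_nhds (isOpen_Ioo.mem_nhds hm)] with x hx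
  rw [heq x hx, complexMGF_ofReal]

/-- If the moment generating function of a nonnegative `X` is finite on `(0, T₁)` and extends
analytically to the strip `0 < Re z < T₂`, then it is finite on `(0, T₂)`. -/
theorem Ioo_subset_integrableExpSet_of_analyticOnNhd {Ω : Type*} [MeasurableSpace Ω]
    {μ : Measure Ω} [IsFiniteMeasure μ] {X : Ω → ℝ} (hX : ∀ᵐ ω ∂μ, 0 ≤ X ω) {g : ℂ → ℂ}
    {T₁ T₂ : ℝ} (hT₁ : 0 < T₁) (hint : Set.Ioo 0 T₁ ⊆ integrableExpSet X μ)
    (hg : AnalyticOnNhd ℂ g {z : ℂ | z.re ∈ Set.Ioo 0 T₂})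
    (heq : ∀ t ∈ Set.Ioo 0 T₁, g t = mgf X μ t) :
    Set.Ioo 0 T₂ ⊆ integrableExpSet X μ := by
  intro t ht
  by_contra htA
  have hdown {u s : ℝ} (hu : u ∈ integrableExpSet X μ) (hs : 0 ≤ s) (hsu : s ≤ u) :
      s ∈ integrableExpSet X μ := integrable_exp_mul_of_nonneg_of_le hu hs hsu
  have hub : ∀ u ∈ integrableExpSet X μ, u ≤ t := fun u hu ↦
    not_lt.1 fun h ↦ htA (hdown hu ht.1.le h.le)
  have hbdd : BddAbove (integrableExpSet X μ) := ⟨t, hub⟩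
  have hzero : (0 : ℝ) ∈ integrableExpSet X μ := by simp [integrableExpSet]
  set S := sSup (integrableExpSet X μ)
  have hSt : S ≤ t := csSup_le ⟨0, hzero⟩ hub
  have hTS : T₁ ≤ S := le_of_forall_lt_imp_le_of_dense fun s hs ↦ by
    rcases le_or_gt s 0 with h | h
    · exact h.trans (le_csSup hbdd hzero)
    · exact le_csSup hbdd (hint ⟨h, hs⟩)
  have hsub : Set.Ioo 0 S ⊆ integrableExpSet X μ := fun s hs ↦ by
    obtain ⟨u, hu, hsu⟩ := exists_lt_of_lt_csSup ⟨0, hzero⟩ hs.2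
    exact hdown hu hs.1.le hsu.le
  have hE := eqOn_complexMGF_of_eqOn_mgf hT₁ hTS hsub
    (hg.mono fun z hz ↦ ⟨hz.1, hz.2.trans_le (hSt.trans ht.2.le)⟩) heq
  obtain ⟨δ, hδ, hδm⟩ := exists_between
    (lt_min (div_pos (hT₁.trans_le hTS) three_pos) (sub_pos.2 (hSt.trans_lt ht.2)))
  obtain ⟨hδS, hδT⟩ := lt_min_iff.1 hδm
  have hmem : S - δ ∈ Set.Ioo 0 S := ⟨by linarith, by linarith⟩
  have hstrip : IsOpen {z : ℂ | z.re ∈ Set.Ioo 0 S} := isOpen_Ioo.preimage Complex.continuous_re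
  have hlarge : S + δ / 2 ∈ integrableExpSet X μ := by
    refine mem_integrableExpSet_of_eventuallyEq_complexMGF hX (g := g) (c := S - δ) (r := 2 * δ)
      (interior_maximal hsub isOpen_Ioo hmem)
      (hg.differentiableOn.mono fun z hz ↦ ?_)
      (hE.eventuallyEq_of_mem (hstrip.mem_nhds hmem))
      (by linarith) (by linarith)
    have h := (Complex.abs_re_le_norm (z - ((S - δ : ℝ) : ℂ))).trans_lt
      (mem_ball_iff_norm.1 hz)
    rw [Complex.sub_re, Complex.ofReal_re, abs_lt] at h
    exact ⟨by linarith, by linarith⟩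
  linarith [le_csSup hbdd hlarge]

/-- If a finite Borel measure `ν` on `[0, ∞)` has finite exponential moments
`∫ e^{tλ} dν(λ)` for `t ∈ (0, T₁)`, `g` is analytic on the strip `{0 < Re z < T₂}`, and the
Laplace-type transform agrees with `g` on `(0, T₁)`, then the transform is finite and agrees
with `g` on all of `(0, T₂)`. -/
theorem stmt_1 (T₁ T₂ : ℝ) (hT₁ : 0 < T₁) (hT₁₂ : T₁ < T₂)
    (ν : Measure ℝ) [IsFiniteMeasure ν] (hsupp : ν (Set.Iio 0) = 0)
    (g : ℂ → ℂ) (hg : AnalyticOnNhd ℂ g {z : ℂ | z.re ∈ Set.Ioo 0 T₂})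
    (hfin : ∀ t ∈ Set.Ioo 0 T₁,
      ∫⁻ l in Set.Ici (0 : ℝ), ENNReal.ofReal (Real.exp (t * l)) ∂ν < ⊤)
    (heq : ∀ t ∈ Set.Ioo 0 T₁,
      g t = ((∫⁻ l in Set.Ici (0 : ℝ), ENNReal.ofReal (Real.exp (t * l)) ∂ν).toReal : ℂ)) :
    ∀ t ∈ Set.Ioo 0 T₂,
      (∫⁻ l in Set.Ici (0 : ℝ), ENNReal.ofReal (Real.exp (t * l)) ∂ν) < ⊤ ∧
      g t = ((∫⁻ l in Set.Ici (0 : ℝ), ENNReal.ofReal (Real.exp (t * l)) ∂ν).toReal : ℂ) := by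
  set μ := ν.restrict (Set.Ici (0 : ℝ))
  have hX : ∀ᵐ l ∂μ, 0 ≤ id l := ae_restrict_mem measurableSet_Ici
  have hmem (t : ℝ) : t ∈ integrableExpSet id μ ↔
      ∫⁻ l, ENNReal.ofReal (Real.exp (t * l)) ∂μ < ⊤ := by
    rw [← hasFiniteIntegral_iff_ofReal (ae_of_all _ fun l ↦ (Real.exp_pos _).le)]
    exact and_iff_right (by fun_prop)
  have hmgf (t : ℝ) :
      mgf id μ t = (∫⁻ l, ENNReal.ofReal (Real.exp (t * l)) ∂μ).toReal :=
    integral_eq_lintegral_of_nonneg_ae (ae_of_all _ fun l ↦ (Real.exp_pos _).le) (by fun_prop)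
  have hagree : ∀ t ∈ Set.Ioo 0 T₁, g t = mgf id μ t := fun t ht ↦ by rw [hmgf, heq t ht]
  have hsub := Ioo_subset_integrableExpSet_of_analyticOnNhd hX hT₁
    (fun t ht ↦ (hmem t).2 (hfin t ht)) hg hagree
  intro t ht
  refine ⟨(hmem t).1 (hsub ht), ?_⟩
  rw [← hmgf, ← complexMGF_ofReal]
  exact eqOn_complexMGF_of_eqOn_mgf hT₁ hT₁₂.le hsub hg hagree (by simpa using ht)
end

section
/- Let N be a Borel measure on ℝ with N((−∞, λ]) < ∞ for every λ ∈ ℝ, and let c ∈ (0, ∞). Assume: (i) ∫_{[0,∞)} e^{−tλ} dN(λ) < ∞ for every t > 0; (ii) ∫_ℝ e^{−tλ} dN(λ) < ∞ for every t ∈ (0, c); and (iii) ∫_ℝ e^{−tλ} dN(λ) = ∞ for every t > c. Then limsup_{λ→−∞} (1/(−λ)) log N((−∞, λ]) = −c. -/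
open MeasureTheory Filter

/-- The normalized logarithm of `x` is at most `a` exactly when `x ≤ e^{ap}`. -/
lemma EReal.one_div_mul_log_le_iff {p : ℝ} (hp : 0 < p) (a : ℝ) (x : ENNReal) :
    ((1 / p : ℝ) : EReal) * ENNReal.log x ≤ (a : EReal) ↔
      x ≤ ENNReal.ofReal (Real.exp (p * a)) := by
  have hdiv : ((1 / p : ℝ) : EReal) * ENNReal.log x = ENNReal.log x / (p : EReal) := by
    rw [one_div, EReal.coe_inv, EReal.div_eq_inv_mul]
  rw [hdiv, EReal.div_le_iff_le_mul (by exact_mod_cast hp) (EReal.coe_ne_top p),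
    ← EReal.coe_mul, ← EReal.exp_coe, ← ENNReal.logOrderIso_apply,
    ← EReal.expOrderIso_apply, ← ENNReal.logOrderIso_symm, OrderIso.le_symm_apply]

/-- Chernoff bound for the distribution function. -/
lemma measure_Iic_le_exp_mul_lintegral_exp (N : Measure ℝ) {t : ℝ} (ht : 0 ≤ t) (l : ℝ) :
    N (Set.Iic l) ≤ ENNReal.ofReal (Real.exp (t * l)) *
      ∫⁻ x, ENNReal.ofReal (Real.exp (-t * x)) ∂N := by
  rw [← lintegral_const_mul _ (by fun_prop), ← lintegral_indicator_one measurableSet_Iic]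
  refine lintegral_mono fun x => ?_
  refine Set.indicator_apply_le' (fun hx : x ≤ l => ?_) fun _ => bot_le
  rw [← ENNReal.ofReal_mul (Real.exp_nonneg _), ← Real.exp_add, Pi.one_apply,
    ENNReal.one_le_ofReal, Real.one_le_exp_iff]
  nlinarith

/-- If the distribution function is `O(e^{bλ})` at `-∞`, then `e^{-tλ}` is integrable over the
negative half-line for every `t < b`. -/
lemma setLIntegral_exp_lt_top_of_measure_Iic_le (N : Measure ℝ)
    (hfin : ∀ l : ℝ, N (Set.Iic l) < ⊤) {b t : ℝ} (ht : 0 ≤ t) (htb : t < b)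
    (hN : ∀ᶠ l in atBot, N (Set.Iic l) ≤ ENNReal.ofReal (Real.exp (b * l))) :
    ∫⁻ l in Set.Iic (0 : ℝ), ENNReal.ofReal (Real.exp (-t * l)) ∂N < ⊤ := by
  set M : ℕ → ℝ := fun n => (N (Set.Iic (-(n : ℝ)))).toReal with hM
  have hpoint : ∀ x ∈ Set.Iic (0 : ℝ), ENNReal.ofReal (Real.exp (-t * x)) ≤
      ∑' n : ℕ, (Set.Iic (-(n : ℝ))).indicator
        (fun _ => ENNReal.ofReal (Real.exp (t * (n + 1)))) x := by
    intro x hx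
    have hx0 : 0 ≤ -x := neg_nonneg.2 hx
    refine le_trans ?_ (ENNReal.le_tsum ⌊-x⌋₊)
    rw [Set.indicator_of_mem (by
      rw [Set.mem_Iic]; linarith [Nat.floor_le hx0])]
    refine ENNReal.ofReal_le_ofReal (Real.exp_le_exp.2 ?_)
    nlinarith [Nat.lt_floor_add_one (-x)]
  have hsum : Summable fun n : ℕ => Real.exp (t * (n + 1)) * M n := by
    have hgeom : Summable fun n : ℕ => Real.exp t * Real.exp (n * (t - b)) :=
      (Real.summable_exp_nat_mul_iff.2 (sub_neg.2 htb)).mul_left _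
    refine hgeom.of_norm_bounded_eventually_nat ?_
    have hlim : Tendsto (fun n : ℕ => -(n : ℝ)) atTop atBot :=
      tendsto_neg_atTop_atBot.comp tendsto_natCast_atTop_atTop
    filter_upwards [hlim.eventually hN] with n hn
    have hMn : M n ≤ Real.exp (b * -(n : ℝ)) :=
      ENNReal.toReal_le_of_le_ofReal (Real.exp_nonneg _) hn
    rw [Real.norm_of_nonneg (mul_nonneg (Real.exp_nonneg _) ENNReal.toReal_nonneg)]
    calc Real.exp (t * (n + 1)) * M n
        ≤ Real.exp (t * (n + 1)) * Real.exp (b * -(n : ℝ)) := by gcongr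
      _ = Real.exp t * Real.exp (n * (t - b)) := by
        rw [← Real.exp_add, ← Real.exp_add]; ring_nf
  calc ∫⁻ l in Set.Iic (0 : ℝ), ENNReal.ofReal (Real.exp (-t * l)) ∂N
      ≤ ∫⁻ l in Set.Iic (0 : ℝ), ∑' n : ℕ, (Set.Iic (-(n : ℝ))).indicator
          (fun _ => ENNReal.ofReal (Real.exp (t * (n + 1)))) l ∂N :=
        setLIntegral_mono' measurableSet_Iic hpoint
    _ ≤ ∫⁻ l, ∑' n : ℕ, (Set.Iic (-(n : ℝ))).indicator
          (fun _ => ENNReal.ofReal (Real.exp (t * (n + 1)))) l ∂N := setLIntegral_le_lintegral _ _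
    _ = ∑' n : ℕ, ENNReal.ofReal (Real.exp (t * (n + 1)) * M n) := by
        rw [lintegral_tsum fun n => (measurable_const.indicator measurableSet_Iic).aemeasurable]
        refine tsum_congr fun n => ?_
        rw [lintegral_indicator_const measurableSet_Iic, ENNReal.ofReal_mul (Real.exp_nonneg _),
          hM, ENNReal.ofReal_toReal (hfin _).ne]
    _ < ⊤ := hsum.tsum_ofReal_lt_top

/-- Let `N` be a Borel measure on `ℝ` with finite distribution function and
`c ∈ (0, ∞)`. If `∫_{[0,∞)} e^{-tλ} dN < ∞` for all `t > 0`, `∫_ℝ e^{-tλ} dN < ∞` for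
`t ∈ (0, c)` and `= ∞` for `t > c`, then
`limsup_{λ → -∞} (1/(-λ)) log N((-∞, λ]) = -c` (with `log 0 = -∞`, in the extended reals). -/
theorem stmt_3 (N : Measure ℝ) (hfin : ∀ l : ℝ, N (Set.Iic l) < ⊤) (c : ℝ) (hc : 0 < c)
    (h1 : ∀ t : ℝ, 0 < t →
      ∫⁻ l in Set.Ici (0 : ℝ), ENNReal.ofReal (Real.exp (-t * l)) ∂N < ⊤)
    (h2 : ∀ t ∈ Set.Ioo 0 c, ∫⁻ l, ENNReal.ofReal (Real.exp (-t * l)) ∂N < ⊤)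
    (h3 : ∀ t : ℝ, c < t → ∫⁻ l, ENNReal.ofReal (Real.exp (-t * l)) ∂N = ⊤) :
    Filter.limsup (fun l : ℝ => ((1 / (-l) : ℝ) : EReal) * ENNReal.log (N (Set.Iic l)))
      atBot = ((-c : ℝ) : EReal) := by
  refine le_antisymm ?_ ?_
  · by_contra! hlt
    obtain ⟨a, hca, hlim⟩ := EReal.lt_iff_exists_real_btwn.1 hlt
    have hca : -c < a := EReal.coe_lt_coe_iff.1 hca
    refine hlim.not_ge (limsup_le_of_le (by isBoundedDefault) ?_)
    obtain ⟨s, hs, hsc⟩ := exists_between (max_lt hc (neg_lt.1 hca))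
    have hs0 : 0 < s := (le_max_left _ _).trans_lt hs
    have hsa : -a < s := (le_max_right _ _).trans_lt hs
    set K := (∫⁻ l, ENNReal.ofReal (Real.exp (-s * l)) ∂N).toReal with hK
    have hlarge : ∀ᶠ l : ℝ in atBot, K ≤ Real.exp (-(s + a) * l) :=
      (Real.tendsto_exp_atTop.comp
        (tendsto_id.const_mul_atBot_of_neg (by linarith))).eventually_ge_atTop K
    filter_upwards [hlarge, eventually_lt_atBot 0] with l hl hl0
    rw [EReal.one_div_mul_log_le_iff (neg_pos.2 hl0)]
    refine (measure_Iic_le_exp_mul_lintegral_exp N hs0.le l).trans ?_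
    rw [← ENNReal.ofReal_toReal (h2 s ⟨hs0, hsc⟩).ne, ← ENNReal.ofReal_mul (Real.exp_nonneg _)]
    refine ENNReal.ofReal_le_ofReal ?_
    calc Real.exp (s * l) * K ≤ Real.exp (s * l) * Real.exp (-(s + a) * l) := by gcongr
      _ = Real.exp (-l * a) := by rw [← Real.exp_add]; ring_nf
  · by_contra! hlt
    obtain ⟨a, hlim, hac⟩ := EReal.lt_iff_exists_real_btwn.1 hlt
    have hac : a < -c := EReal.coe_lt_coe_iff.1 hac
    obtain ⟨t, hct, hta⟩ := exists_between (lt_neg.1 hac)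
    have hN : ∀ᶠ l in atBot, N (Set.Iic l) ≤ ENNReal.ofReal (Real.exp (-a * l)) := by
      filter_upwards [eventually_lt_of_limsup_lt hlim, eventually_lt_atBot 0] with l hl hl0
      have := (EReal.one_div_mul_log_le_iff (neg_pos.2 hl0) a _).1 hl.le
      rwa [show -a * l = -l * a by ring]
    have hneg := setLIntegral_exp_lt_top_of_measure_Iic_le N hfin (hc.trans hct).le hta hN
    have hunion := lintegral_union_le (μ := N) (fun l => ENNReal.ofReal (Real.exp (-t * l)))
      (Set.Iic 0) (Set.Ici 0)
    rw [Set.Iic_union_Ici, Measure.restrict_univ, h3 t hct] at hunion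
    exact hunion.not_gt (ENNReal.add_lt_top.2 ⟨hneg, h1 t (hc.trans hct)⟩)
end

section
/- Let t > 0 and 0 ≤ a ≤ b ≤ t. Let X : [0,t] × Ω → ℝ² be a jointly measurable stochastic process such that every finite family (X_{t_1}, …, X_{t_m}) is centered Gaussian with E[X_s^{(i)} X_r^{(j)}] = 𝟙_{i=j}(min(s,r) − sr/t) (a two-dimensional Brownian bridge from 0 at time 0 to 0 at time t). Then, as ε → 0+, ∫∫_{a ≤ r ≤ s ≤ b} E[p_ε(X_s − X_r)] dr ds = (2π)^{−1} [ (b−a) log(1/ε) + (b−a) log t + ∫_0^{b−a} (log s − log(t−s)) ds ] + o(1). -/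
open MeasureTheory ProbabilityTheory Filter Topology

/-- The two-dimensional heat kernel `p_ε(x) = (2πε)⁻¹ exp(-|x|²/(2ε))` on `ℝ² = ℝ × ℝ`. -/
noncomputable def pHeat (ε : ℝ) (x : ℝ × ℝ) : ℝ :=
  (2 * Real.pi * ε)⁻¹ * Real.exp (-(x.1 ^ 2 + x.2 ^ 2) / (2 * ε))

lemma integral_exp_neg_sq_div_gaussianReal {ε : ℝ} (hε : 0 < ε) (v : NNReal) :
    ∫ x, Real.exp (-x ^ 2 / (2 * ε)) ∂(gaussianReal 0 v) = √(ε / (ε + v)) := by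
  rcases eq_or_ne v 0 with rfl | hv
  · simp [gaussianReal_zero_var, hε.ne']
  have hv' : (0 : ℝ) < v := by positivity
  rw [integral_gaussianReal_eq_integral_smul hv]
  have h : ∀ x : ℝ, gaussianPDFReal 0 v x • Real.exp (-x ^ 2 / (2 * ε))
      = (√(2 * Real.pi * v))⁻¹ * Real.exp (-((ε + v) / (2 * ε * v)) * x ^ 2) := by
    intro x
    rw [gaussianPDFReal, smul_eq_mul, mul_assoc, ← Real.exp_add]
    congr 2
    field_simp
    ring
  simp_rw [h]
  rw [integral_const_mul, integral_gaussian, ← Real.sqrt_inv, ← Real.sqrt_mul (by positivity)]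
  congr 1
  field_simp

/-- A measure on the plane all of whose linear images are centered Gaussian with variance
proportional to the squared norm of the linear functional is a product of Gaussians. -/
lemma eq_gaussianReal_prod_of_map_linear {μ : Measure (ℝ × ℝ)} [IsFiniteMeasure μ] (v : NNReal)
    (h : ∀ α β : ℝ, μ.map (fun x => α * x.1 + β * x.2)
      = gaussianReal 0 (Real.toNNReal ((α ^ 2 + β ^ 2) * v))) :
    μ = (gaussianReal 0 v).prod (gaussianReal 0 v) := by
  rw [← charFunDual_eq_prod_iff]
  intro L
  have hL : ⇑L = fun x : ℝ × ℝ => L (1, 0) * x.1 + L (0, 1) * x.2 := by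
    ext x
    have hx : x = x.1 • ((1 : ℝ), (0 : ℝ)) + x.2 • ((0 : ℝ), (1 : ℝ)) := by ext <;> simp
    conv_lhs => rw [hx, map_add, map_smul, map_smul]
    simp [mul_comm]
  have h1 : ⇑(L ∘SL ContinuousLinearMap.inl ℝ ℝ ℝ) = fun x => L (1, 0) * x := by
    ext x; simpa using congrFun hL (x, 0)
  have h2 : ⇑(L ∘SL ContinuousLinearMap.inr ℝ ℝ ℝ) = fun x => L (0, 1) * x := by
    ext x; simpa using congrFun hL (0, x)
  have hnn : 0 ≤ ((L (1, 0)) ^ 2 + (L (0, 1)) ^ 2) * (v : ℝ) := by positivity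
  rw [charFunDual_eq_charFun_map_one, charFunDual_eq_charFun_map_one,
    charFunDual_eq_charFun_map_one, h1, h2]
  nth_rewrite 1 [hL]
  rw [h, gaussianReal_map_const_mul, gaussianReal_map_const_mul,
    charFun_gaussianReal, charFun_gaussianReal, charFun_gaussianReal, ← Complex.exp_add,
    Real.coe_toNNReal _ hnn]
  congr 1
  push_cast
  ring

lemma integral_pHeat_gaussianReal_prod {ε : ℝ} (hε : 0 < ε) (v : NNReal) :
    ∫ x, pHeat ε x ∂((gaussianReal 0 v).prod (gaussianReal 0 v))
      = (2 * Real.pi)⁻¹ * (ε + v)⁻¹ := by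
  have h : ∀ x : ℝ × ℝ, pHeat ε x = (2 * Real.pi * ε)⁻¹ *
      (Real.exp (-x.1 ^ 2 / (2 * ε)) * Real.exp (-x.2 ^ 2 / (2 * ε))) := by
    intro x
    rw [pHeat, ← Real.exp_add]
    congr 2
    ring
  simp_rw [h]
  rw [integral_const_mul, integral_prod_mul (fun x : ℝ => Real.exp (-x ^ 2 / (2 * ε)))
    (fun x : ℝ => Real.exp (-x ^ 2 / (2 * ε))), integral_exp_neg_sq_div_gaussianReal hε,
    Real.mul_self_sqrt (by positivity)]
  have : (0 : ℝ) < ε + v := by positivity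
  field_simp

section Bridge

variable {Ω : Type*} [MeasurableSpace Ω] {P : Measure Ω} [IsProbabilityMeasure P]
  {t : ℝ} {X : ℝ → Ω → ℝ × ℝ}

/-- The expected heat kernel evaluated at an increment of a Brownian bridge. -/
lemma integral_pHeat_bridge_increment (ht : 0 < t)
    (hmeas : Measurable (fun p : ℝ × Ω => X p.1 p.2))
    (hGauss : ∀ (m : ℕ) (ts : Fin m → ℝ), (∀ i, ts i ∈ Set.Icc 0 t) →
      ∀ c : Fin m → ℝ × ℝ,
        Measure.map
            (fun ω => ∑ i, ((c i).1 * (X (ts i) ω).1 + (c i).2 * (X (ts i) ω).2)) P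
          = gaussianReal 0
              (Real.toNNReal (∑ i, ∑ j,
                ((c i).1 * (c j).1 + (c i).2 * (c j).2) *
                  (min (ts i) (ts j) - ts i * ts j / t))))
    {r s ε : ℝ} (hr : 0 ≤ r) (hrs : r ≤ s) (hs : s ≤ t) (hε : 0 < ε) :
    ∫ ω, pHeat ε (X s ω - X r ω) ∂P
      = (2 * Real.pi)⁻¹ * (ε + (s - r) * (t - (s - r)) / t)⁻¹ := by
  have hX : ∀ u, Measurable (X u) := fun u => hmeas.comp measurable_prodMk_left
  have hD : Measurable (fun ω => X s ω - X r ω) := (hX s).sub (hX r)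
  have hv : 0 ≤ (s - r) * (t - (s - r)) / t :=
    div_nonneg (mul_nonneg (by linarith) (by linarith)) ht.le
  have : IsProbabilityMeasure (P.map (fun ω => X s ω - X r ω)) :=
    Measure.isProbabilityMeasure_map hD.aemeasurable
  have hlaw := eq_gaussianReal_prod_of_map_linear (μ := P.map (fun ω => X s ω - X r ω))
    (Real.toNNReal ((s - r) * (t - (s - r)) / t)) (by
      intro α β
      have hg := hGauss 2 ![s, r]
        (by intro i; fin_cases i <;> simp <;> constructor <;> linarith) ![(α, β), (-α, -β)]
      rw [Measure.map_map (by fun_prop) hD]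
      convert! hg using 2
      · ext ω
        simp [Fin.sum_univ_two]
        ring
      · simp only [Fin.sum_univ_two, Matrix.cons_val_zero, Matrix.cons_val_one, min_self,
          min_eq_left hrs, min_eq_right hrs, Real.coe_toNNReal _ hv]
        congr 1
        field_simp
        ring)
  have hp : Measurable (pHeat ε) := by unfold pHeat; fun_prop
  rw [← integral_map (φ := fun ω => X s ω - X r ω) hD.aemeasurable hp.aestronglyMeasurable, hlaw,
    integral_pHeat_gaussianReal_prod hε, Real.coe_toNNReal _ hv]

end Bridge

section LogIntegrals

variable {t δ : ℝ}

lemma integral_inv_shifted_parabola (ht : 0 < t) (hδ : 0 < δ) {v : ℝ} (hv : 0 ≤ v) (hvt : v ≤ t) :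
    ∫ u in (0 : ℝ)..v, (δ * (t + δ) / t + u * (t - u) / t)⁻¹
      = t / (t + 2 * δ) *
        (Real.log (v + δ) - Real.log δ - Real.log (t + δ - v) + Real.log (t + δ)) := by
  have hpos : ∀ u ∈ Set.uIcc 0 v, 0 < u + δ ∧ 0 < t + δ - u := by
    intro u hu
    rw [Set.uIcc_of_le hv] at hu
    exact ⟨by linarith [hu.1], by linarith [hu.2]⟩
  have hfac : ∀ u, δ * (t + δ) / t + u * (t - u) / t = (u + δ) * (t + δ - u) / t := by
    intro u; ring
  have h2 : t + 2 * δ ≠ 0 := by positivity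
  rw [intervalIntegral.integral_eq_sub_of_hasDerivAt
    (f := fun u => t / (t + 2 * δ) * (Real.log (u + δ) - Real.log (t + δ - u)))]
  · simp; ring
  · intro u hu
    obtain ⟨h0, h1⟩ := hpos u hu
    have d1 := ((hasDerivAt_id u).add_const δ).log h0.ne'
    have d2 := ((hasDerivAt_id u).const_sub (t + δ)).log h1.ne'
    convert! (d1.sub d2).const_mul (t / (t + 2 * δ)) using 1
    rw [hfac]
    simp only [id]
    have := h0.ne'
    have := h1.ne'
    field_simp
    ring
  · apply ContinuousOn.intervalIntegrable
    apply ContinuousOn.inv₀ (by fun_prop)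
    intro u hu
    obtain ⟨h0, h1⟩ := hpos u hu
    rw [hfac]
    positivity

lemma intervalIntegrable_log_add (c x y : ℝ) :
    IntervalIntegrable (fun v => Real.log (v + c)) volume x y := by
  simpa using (intervalIntegral.intervalIntegrable_log' (a := x + c) (b := y + c)).comp_add_right c

lemma intervalIntegrable_log_const_sub (c x y : ℝ) :
    IntervalIntegrable (fun v => Real.log (c - v)) volume x y := by
  simpa using (intervalIntegral.intervalIntegrable_log' (a := c - x) (b := c - y)).comp_sub_left c

lemma integral_log_add_sub_log_const_sub (c d L : ℝ) :
    ∫ v in (0 : ℝ)..L, (Real.log (v + c) - Real.log (d - v))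
      = (L + c) * Real.log (L + c) - c * Real.log c - d * Real.log d
        + (d - L) * Real.log (d - L) := by
  rw [intervalIntegral.integral_sub (intervalIntegrable_log_add _ _ _)
    (intervalIntegrable_log_const_sub _ _ _),
    intervalIntegral.integral_comp_add_right (fun x => Real.log x),
    intervalIntegral.integral_comp_sub_left (fun x => Real.log x), integral_log, integral_log]
  ring_nf

lemma integral_integral_inv_shifted_parabola (ht : 0 < t) (hδ : 0 < δ) {a b : ℝ} (hab : a ≤ b)
    (hbt : b - a ≤ t) :
    ∫ s in a..b, ∫ r in a..s, (δ * (t + δ) / t + (s - r) * (t - (s - r)) / t)⁻¹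
      = t / (t + 2 * δ) * ((b - a + δ) * Real.log (b - a + δ) - δ * Real.log δ
        - (t + δ) * Real.log (t + δ) + (t + δ - (b - a)) * Real.log (t + δ - (b - a))
        + (b - a) * (Real.log (t + δ) - Real.log δ)) := by
  have hinner : ∀ s, ∫ r in a..s, (δ * (t + δ) / t + (s - r) * (t - (s - r)) / t)⁻¹
      = ∫ u in (0 : ℝ)..(s - a), (δ * (t + δ) / t + u * (t - u) / t)⁻¹ := by
    intro s
    rw [intervalIntegral.integral_comp_sub_left
      (fun u => (δ * (t + δ) / t + u * (t - u) / t)⁻¹), sub_self]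
  simp_rw [hinner]
  rw [intervalIntegral.integral_comp_sub_right
    (fun v => ∫ u in (0 : ℝ)..v, (δ * (t + δ) / t + u * (t - u) / t)⁻¹), sub_self]
  have hL : 0 ≤ b - a := by linarith
  rw [intervalIntegral.integral_congr (g := fun v => t / (t + 2 * δ) *
    ((Real.log (v + δ) - Real.log (t + δ - v)) + (Real.log (t + δ) - Real.log δ)))]
  · rw [intervalIntegral.integral_const_mul, intervalIntegral.integral_add
      ((intervalIntegrable_log_add _ _ _).sub (intervalIntegrable_log_const_sub _ _ _))
      intervalIntegrable_const, integral_log_add_sub_log_const_sub,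
      intervalIntegral.integral_const, smul_eq_mul, sub_zero]
  · intro v hv
    rw [Set.uIcc_of_le hL] at hv
    simp only
    rw [integral_inv_shifted_parabola ht hδ hv.1 (hv.2.trans hbt)]
    ring

/-- The asymptotics of the regularized integral, in the parametrization `ε = δ (t + δ) / t`. -/
lemma tendsto_integral_inv_shifted_parabola (ht : 0 < t) {a b : ℝ} (hab : a ≤ b)
    (hbt : b - a ≤ t) :
    Tendsto (fun δ : ℝ =>
        (∫ s in a..b, ∫ r in a..s, (δ * (t + δ) / t + (s - r) * (t - (s - r)) / t)⁻¹)
          - ((b - a) * Real.log (δ * (t + δ) / t)⁻¹ + (b - a) * Real.log t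
              + ∫ s in (0:ℝ)..(b - a), (Real.log s - Real.log (t - s))))
      (𝓝[>] 0) (𝓝 0) := by
  set L := b - a with hL
  have hlim := integral_log_add_sub_log_const_sub 0 t L
  simp only [add_zero, zero_mul, sub_zero] at hlim
  let Φ : ℝ → ℝ := fun δ => t / (t + 2 * δ) * ((L + δ) * Real.log (L + δ) - δ * Real.log δ
        - (t + δ) * Real.log (t + δ) + (t + δ - L) * Real.log (t + δ - L)
        + L * Real.log (t + δ)) + 2 * L / (t + 2 * δ) * (δ * Real.log δ) + L * Real.log (t + δ)
        - 2 * L * Real.log t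
        - (L * Real.log L - t * Real.log t + (t - L) * Real.log (t - L))
  have hΦ0 : Φ 0 = 0 := by
    simp only [Φ, add_zero, mul_zero, zero_mul, div_self ht.ne']
    ring
  have hΦ : ContinuousAt Φ 0 := by
    have hH : ∀ f : ℝ → ℝ, Continuous f → ContinuousAt (fun δ => f δ * Real.log (f δ)) 0 :=
      fun f hf => (Real.continuous_mul_log.comp hf).continuousAt
    have h1 := hH (fun δ => L + δ) (by fun_prop)
    have h2 := hH (fun δ => δ) (by fun_prop)
    have h3 := hH (fun δ => t + δ) (by fun_prop)
    have h4 := hH (fun δ => t + δ - L) (by fun_prop)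
    have h5 : ContinuousAt (fun δ => Real.log (t + δ)) 0 :=
      ContinuousAt.log (by fun_prop) (by simpa using ht.ne')
    have h6 : ContinuousAt (fun δ : ℝ => t / (t + 2 * δ)) 0 :=
      ContinuousAt.div (by fun_prop) (by fun_prop) (by simpa using ht.ne')
    have h7 : ContinuousAt (fun δ : ℝ => 2 * L / (t + 2 * δ)) 0 :=
      ContinuousAt.div (by fun_prop) (by fun_prop) (by simpa using ht.ne')
    exact ((((h6.mul ((((h1.sub h2).sub h3).add h4).add (h5.const_mul L))).add (h7.mul h2)).add
      (h5.const_mul L)).sub continuousAt_const).sub continuousAt_const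
  have hT : Tendsto Φ (𝓝[>] 0) (𝓝 0) := by
    simpa [hΦ0] using hΦ.tendsto.mono_left nhdsWithin_le_nhds
  refine hT.congr' ?_
  filter_upwards [self_mem_nhdsWithin] with δ hδ
  have hδ : 0 < δ := hδ
  have htδ : 0 < t + δ := by linarith
  rw [integral_integral_inv_shifted_parabola ht hδ hab hbt, ← hL, hlim, Real.log_inv,
    Real.log_div (by positivity) ht.ne', Real.log_mul hδ.ne' htδ.ne']
  have h2 : t + 2 * δ ≠ 0 := by positivity
  simp only [Φ]
  field_simp
  ring

end LogIntegrals

/-- For a two-dimensional Brownian bridge `X` on `[0, t]` (from `0` to `0`),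
meaning a jointly measurable process whose finite-dimensional marginals are centered Gaussian
with covariance `E[X_s⁽ⁱ⁾ X_r⁽ʲ⁾] = 𝟙_{i=j}(min(s,r) - sr/t)`, and `0 ≤ a ≤ b ≤ t`, one has,
as `ε → 0+`,
`∫∫_{a ≤ r ≤ s ≤ b} E[p_ε(X_s - X_r)] dr ds
  = (2π)⁻¹ [(b-a) log(1/ε) + (b-a) log t + ∫_0^{b-a} (log s - log(t-s)) ds] + o(1)`.
The Gaussianity of finite families is expressed through the law of all linear functionals. -/
theorem stmt_5 {Ω : Type*} [MeasurableSpace Ω] (P : Measure Ω) [IsProbabilityMeasure P]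
    (t a b : ℝ) (ht : 0 < t) (ha : 0 ≤ a) (hab : a ≤ b) (hbt : b ≤ t)
    (X : ℝ → Ω → ℝ × ℝ) (hmeas : Measurable (fun p : ℝ × Ω => X p.1 p.2))
    (hGauss : ∀ (m : ℕ) (ts : Fin m → ℝ), (∀ i, ts i ∈ Set.Icc 0 t) →
      ∀ c : Fin m → ℝ × ℝ,
        Measure.map
            (fun ω => ∑ i, ((c i).1 * (X (ts i) ω).1 + (c i).2 * (X (ts i) ω).2)) P
          = gaussianReal 0
              (Real.toNNReal (∑ i, ∑ j,
                ((c i).1 * (c j).1 + (c i).2 * (c j).2) *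
                  (min (ts i) (ts j) - ts i * ts j / t)))) :
    Tendsto (fun ε : ℝ =>
        (∫ s in a..b, ∫ r in a..s, ∫ ω, pHeat ε (X s ω - X r ω) ∂P)
          - (2 * Real.pi)⁻¹ * ((b - a) * Real.log ε⁻¹ + (b - a) * Real.log t
              + ∫ s in (0:ℝ)..(b - a), (Real.log s - Real.log (t - s))))
      (𝓝[>] 0) (𝓝 0) := by
  have hδ0 : Tendsto (fun ε : ℝ => (√(t ^ 2 + 4 * (ε * t)) - t) / 2) (𝓝[>] 0) (𝓝[>] 0) := by
    refine tendsto_nhdsWithin_iff.2 ⟨?_, ?_⟩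
    · have hc : Continuous (fun ε : ℝ => (√(t ^ 2 + 4 * (ε * t)) - t) / 2) := by fun_prop
      simpa [Real.sqrt_sq ht.le] using (hc.tendsto 0).mono_left nhdsWithin_le_nhds
    · filter_upwards [self_mem_nhdsWithin] with ε hε
      have hε : 0 < ε := hε
      have : t < √(t ^ 2 + 4 * (ε * t)) := Real.lt_sqrt_of_sq_lt (by nlinarith [mul_pos hε ht])
      simp only [Set.mem_Ioi]
      linarith
  have hlim := ((tendsto_integral_inv_shifted_parabola ht hab (by linarith)).comp hδ0).const_mul
    (2 * Real.pi)⁻¹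
  rw [mul_zero] at hlim
  refine hlim.congr' ?_
  filter_upwards [self_mem_nhdsWithin] with ε hε
  have hε : 0 < ε := hε
  have hsqrt : √(t ^ 2 + 4 * (ε * t)) ^ 2 = t ^ 2 + 4 * (ε * t) := Real.sq_sqrt (by positivity)
  have hεδ : (√(t ^ 2 + 4 * (ε * t)) - t) / 2 * (t + (√(t ^ 2 + 4 * (ε * t)) - t) / 2) / t
      = ε := by
    rw [div_eq_iff ht.ne']
    linear_combination hsqrt / 4
  simp only [Function.comp_apply, hεδ]
  rw [mul_sub, ← intervalIntegral.integral_const_mul]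
  congr 1
  refine intervalIntegral.integral_congr fun s hs => ?_
  rw [Set.uIcc_of_le hab] at hs
  rw [← intervalIntegral.integral_const_mul]
  refine intervalIntegral.integral_congr fun r hr => ?_
  rw [Set.uIcc_of_le hs.1] at hr
  exact (integral_pHeat_bridge_increment ht hmeas hGauss (ha.trans hr.1) hr.2
    (hs.2.trans hbt) hε).symm
end

section
/- Let 0 ≤ a < b. Let B : [0,∞) × Ω → ℝ² be a jointly measurable stochastic process such that every finite family (B_{t_1}, …, B_{t_m}) is centered Gaussian with E[B_s^{(i)} B_r^{(j)}] = 𝟙_{i=j} min(s,r) (a two-dimensional Brownian motion). Then, as ε → 0+, ∫∫_{a ≤ r ≤ s ≤ b} E[p_ε(B_s − B_r)] dr ds = ((b−a)/(2π)) ( log(1/ε) + log(b−a) − 1 ) + o(1). -/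
open MeasureTheory ProbabilityTheory Filter Topology

theorem map_eq_prod_gaussianReal {Ω : Type*} [MeasurableSpace Ω] (P : Measure Ω)
    [IsProbabilityMeasure P] (X : Ω → ℝ × ℝ) (hX : Measurable X) (v : NNReal)
    (h : ∀ c : ℝ × ℝ, Measure.map (fun ω => c.1 * (X ω).1 + c.2 * (X ω).2) P
      = gaussianReal 0 (Real.toNNReal ((c.1 ^ 2 + c.2 ^ 2) * v))) :
    Measure.map X P = (gaussianReal 0 v).prod (gaussianReal 0 v) := by
  have : IsProbabilityMeasure (Measure.map X P) := Measure.isProbabilityMeasure_map hX.aemeasurable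
  apply Measure.ext_of_charFunDual
  ext L
  have hL : ∀ x : ℝ × ℝ, L x = L (1, 0) * x.1 + L (0, 1) * x.2 := by
    intro x
    have hx : x = x.1 • ((1, 0) : ℝ × ℝ) + x.2 • ((0, 1) : ℝ × ℝ) := by ext <;> simp
    conv_lhs => rw [hx]
    simp only [map_add, map_smul, smul_eq_mul]
    ring
  have h1 := h (L (1, 0), L (0, 1))
  rw [charFunDual_prod, charFunDual_eq_charFun_map_one, charFunDual_eq_charFun_map_one,
    charFunDual_eq_charFun_map_one, Measure.map_map L.continuous.measurable hX]
  have e0 : (L ∘ X) = fun ω => L (1, 0) * (X ω).1 + L (0, 1) * (X ω).2 := by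
    ext ω; exact hL (X ω)
  have e1 : (L.comp (ContinuousLinearMap.inl ℝ ℝ ℝ) : ℝ → ℝ) = fun x => L (1, 0) * x := by
    ext x; simp [hL (x, 0)]
  have e2 : (L.comp (ContinuousLinearMap.inr ℝ ℝ ℝ) : ℝ → ℝ) = fun x => L (0, 1) * x := by
    ext x; simp [hL (0, x)]
  rw [e0, h1, e1, e2, gaussianReal_map_const_mul, gaussianReal_map_const_mul,
    charFun_gaussianReal, charFun_gaussianReal, charFun_gaussianReal, ← Complex.exp_add,
    Real.coe_toNNReal _ (by positivity)]
  congr 1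
  push_cast
  simp
  ring

theorem integral_exp_neg_sq_gaussianReal (v : NNReal) {ε : ℝ} (hε : 0 < ε) :
    ∫ x, Real.exp (-x ^ 2 / (2 * ε)) ∂(gaussianReal 0 v) = √(ε / (v + ε)) := by
  by_cases hv : v = 0
  · simp [hv, hε.ne']
  have hv' : (0 : ℝ) < v := by positivity
  rw [integral_gaussianReal_eq_integral_smul hv]
  have h (x : ℝ) : gaussianPDFReal 0 v x • Real.exp (-x ^ 2 / (2 * ε))
      = (√(2 * Real.pi * v))⁻¹ * Real.exp (-((v + ε) / (2 * ε * v)) * x ^ 2) := by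
    rw [gaussianPDFReal, smul_eq_mul, mul_assoc, ← Real.exp_add]
    congr 2
    field_simp
    ring
  simp_rw [h]
  rw [integral_const_mul, integral_gaussian, ← Real.sqrt_inv, ← Real.sqrt_mul (by positivity)]
  congr 1
  field_simp

theorem integral_pHeat_prod_gaussianReal (v : NNReal) {ε : ℝ} (hε : 0 < ε) :
    ∫ x, pHeat ε x ∂((gaussianReal 0 v).prod (gaussianReal 0 v))
      = (2 * Real.pi)⁻¹ * (v + ε)⁻¹ := by
  have h (x : ℝ × ℝ) : pHeat ε x = (2 * Real.pi * ε)⁻¹ *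
      (Real.exp (-x.1 ^ 2 / (2 * ε)) * Real.exp (-x.2 ^ 2 / (2 * ε))) := by
    rw [pHeat, ← Real.exp_add]
    congr 2
    ring
  simp_rw [h]
  rw [integral_const_mul, integral_prod_mul (fun x : ℝ => Real.exp (-x ^ 2 / (2 * ε)))
    (fun x : ℝ => Real.exp (-x ^ 2 / (2 * ε))), integral_exp_neg_sq_gaussianReal v hε,
    Real.mul_self_sqrt (by positivity)]
  field_simp

theorem integral_integral_inv_sub_add (a b : ℝ) (hab : a < b) {ε : ℝ} (hε : 0 < ε) :
    ∫ s in a..b, ∫ r in a..s, (s - r + ε)⁻¹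
      = (b - a + ε) * Real.log (b - a + ε) - (b - a) - ε * Real.log ε
        - (b - a) * Real.log ε := by
  have h : ∀ s ∈ Set.uIcc a b, ∫ r in a..s, (s - r + ε)⁻¹
      = Real.log (s + (ε - a)) - Real.log ε := by
    intro s hs
    rw [Set.uIcc_of_le hab.le] at hs
    have e : ∀ r, (s - r + ε)⁻¹ = ((s + ε) - r)⁻¹ := fun r => by ring
    simp_rw [e]
    rw [intervalIntegral.integral_comp_sub_left (fun x => x⁻¹),
      integral_inv_of_pos (by linarith) (by linarith [hs.1]),
      Real.log_div (by linarith [hs.1]) (by linarith)]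
    ring_nf
  rw [intervalIntegral.integral_congr h, intervalIntegral.integral_sub,
    intervalIntegral.integral_comp_add_right (fun x => Real.log x), integral_log,
    intervalIntegral.integral_const]
  · simp only [smul_eq_mul]
    ring_nf
  · apply ContinuousOn.intervalIntegrable
    intro s hs
    rw [Set.uIcc_of_le hab.le] at hs
    exact (ContinuousAt.log (by fun_prop) (by linarith [hs.1])).continuousWithinAt
  · simp

/-- For a two-dimensional Brownian motion `B` (jointly measurable, with
centered Gaussian finite-dimensional marginals of covariance `𝟙_{i=j} min(s,r)`) and
`0 ≤ a < b`, one has, as `ε → 0+`,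
`∫∫_{a ≤ r ≤ s ≤ b} E[p_ε(B_s - B_r)] dr ds = ((b-a)/(2π))(log(1/ε) + log(b-a) - 1) + o(1)`.
The Gaussianity of finite families is expressed through the law of all linear functionals. -/
theorem stmt_7 {Ω : Type*} [MeasurableSpace Ω] (P : Measure Ω) [IsProbabilityMeasure P]
    (a b : ℝ) (ha : 0 ≤ a) (hab : a < b)
    (B : ℝ → Ω → ℝ × ℝ) (hmeas : Measurable (fun p : ℝ × Ω => B p.1 p.2))
    (hGauss : ∀ (m : ℕ) (ts : Fin m → ℝ), (∀ i, 0 ≤ ts i) →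
      ∀ c : Fin m → ℝ × ℝ,
        Measure.map
            (fun ω => ∑ i, ((c i).1 * (B (ts i) ω).1 + (c i).2 * (B (ts i) ω).2)) P
          = gaussianReal 0
              (Real.toNNReal (∑ i, ∑ j,
                ((c i).1 * (c j).1 + (c i).2 * (c j).2) * min (ts i) (ts j)))) :
    Tendsto (fun ε : ℝ =>
        (∫ s in a..b, ∫ r in a..s, ∫ ω, pHeat ε (B s ω - B r ω) ∂P)
          - ((b - a) / (2 * Real.pi)) *
              (Real.log ε⁻¹ + Real.log (b - a) - 1))
      (𝓝[>] 0) (𝓝 0) := by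
  have hX (s r : ℝ) (hr : 0 ≤ r) (hrs : r ≤ s) {ε : ℝ} (hε : 0 < ε) :
      ∫ ω, pHeat ε (B s ω - B r ω) ∂P = (2 * Real.pi)⁻¹ * (s - r + ε)⁻¹ := by
    have hB (t : ℝ) : Measurable (B t) := hmeas.comp measurable_prodMk_left
    have hm : Measurable (fun ω => B s ω - B r ω) := (hB s).sub (hB r)
    have hlaw := map_eq_prod_gaussianReal P _ hm (Real.toNNReal (s - r)) (by
      intro c
      have := hGauss 2 ![s, r] (by intro i; fin_cases i <;> simp <;> linarith) ![c, -c]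
      simp only [Fin.sum_univ_two, Matrix.cons_val_zero, Matrix.cons_val_one, Prod.fst_neg,
        Prod.snd_neg, min_self, min_eq_right hrs, min_eq_left hrs] at this
      convert this using 2
      · ext ω
        simp only [Prod.fst_sub, Prod.snd_sub]
        ring
      · rw [Real.coe_toNNReal _ (by linarith)]
        congr 1
        ring)
    have hp : Measurable (pHeat ε) := by
      unfold pHeat
      fun_prop
    rw [← integral_map hm.aemeasurable hp.aestronglyMeasurable, hlaw,
      integral_pHeat_prod_gaussianReal _ hε, Real.coe_toNNReal _ (by linarith)]
  have hI {ε : ℝ} (hε : 0 < ε) :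
      ∫ s in a..b, ∫ r in a..s, ∫ ω, pHeat ε (B s ω - B r ω) ∂P
        = (2 * Real.pi)⁻¹ * ((b - a + ε) * Real.log (b - a + ε) - (b - a) - ε * Real.log ε
        - (b - a) * Real.log ε) := by
    rw [← integral_integral_inv_sub_add a b hab hε, ← intervalIntegral.integral_const_mul]
    apply intervalIntegral.integral_congr
    intro s hs
    rw [Set.uIcc_of_le hab.le] at hs
    simp only
    rw [← intervalIntegral.integral_const_mul]
    apply intervalIntegral.integral_congr
    intro r hr
    rw [Set.uIcc_of_le hs.1] at hr
    exact hX s r (ha.trans hr.1) hr.2 hε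
  have hlim : Tendsto (fun ε : ℝ => (2 * Real.pi)⁻¹ * ((b - a + ε) * Real.log (b - a + ε)
      - ε * Real.log ε - (b - a) * Real.log (b - a))) (𝓝[>] 0) (𝓝 0) := by
    have hc : Continuous (fun ε : ℝ => (2 * Real.pi)⁻¹ * ((b - a + ε) * Real.log (b - a + ε)
        - ε * Real.log ε - (b - a) * Real.log (b - a))) := by
      have h1 := Real.continuous_mul_log
      have h2 : Continuous (fun ε : ℝ => (b - a + ε) * Real.log (b - a + ε)) :=
        h1.comp (continuous_const.add continuous_id)
      fun_prop
    simpa using (hc.tendsto 0).mono_left nhdsWithin_le_nhds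
  refine hlim.congr' ?_
  filter_upwards [self_mem_nhdsWithin] with ε hε
  rw [hI hε, Real.log_inv]
  ring
end
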